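/- arXiv:1510.03814 — 2 statements merged into one kernel-verified Lean document; each statement's English description precedes it below -/
import Mathlib

section
/- Let ι be a finite index set, c : ι → ℝ with c(i) ≥ 0 for all i, and x, y : ι → ℝ such that for every i ∈ ι, x(i) ∈ {0, c(i)} and y(i) ∈ {0, c(i)}. Then (Σ_i min(x(i)², y(i)²)) / (Σ_i max(x(i)², y(i)²)) = (Σ_i x(i)·y(i)) / (Σ_i x(i)² + Σ_i y(i)² − Σ_i x(i)·y(i)), with the convention 0/0 = 0. In particular, the normalization Sim(u,v)/(Sim(u,u)+Sim(v,v)−Sim(u,v)) of an inner-product similarity whose feature vectors have entries in {0, c(i)} in each coordinate i is a generalized Jaccard similarity J(x², y²) = Σ_i min(x(i)²,y(i)²) / Σ_i max(x(i)²,y(i)²). -/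
/-- If the coordinates of `x` and `y` lie in `{0, c i}` with `c i ≥ 0`, then the
generalized Jaccard similarity of `x²` and `y²` coincides with the normalized inner-product
similarity (with the convention `0 / 0 = 0`). -/
theorem stmt3 {ι : Type*} [Fintype ι] (c x y : ι → ℝ)
    (hc : ∀ i, 0 ≤ c i)
    (hx : ∀ i, x i = 0 ∨ x i = c i) (hy : ∀ i, y i = 0 ∨ y i = c i) :
    (∑ i, min ((x i) ^ 2) ((y i) ^ 2)) / (∑ i, max ((x i) ^ 2) ((y i) ^ 2)) =
      (∑ i, x i * y i) /
        ((∑ i, (x i) ^ 2) + (∑ i, (y i) ^ 2) - ∑ i, x i * y i) := by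
  have hmin : ∀ i, min ((x i) ^ 2) ((y i) ^ 2) = x i * y i := fun i => by
    rcases hx i with h | h <;> rcases hy i with h' | h' <;> simp [h, h', sq, mul_self_nonneg]
  have hmax : ∀ i, max ((x i) ^ 2) ((y i) ^ 2) = (x i) ^ 2 + (y i) ^ 2 - x i * y i := fun i => by
    rw [← hmin i, ← min_add_max, add_sub_cancel_left]
  simp only [hmin, hmax, Finset.sum_add_distrib, Finset.sum_sub_distrib]
end

section
/- Let G be a finite vertex-labeled graph. Fix r ≥ 1 and nonnegative reals λ₁,…,λ_r, and define SimLW and SimKN with these same parameters. Then for all vertices u, v of G, SimLW(u,v) ≤ SimKN(u,v). -/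
/-- The number of walks of length `i` in `G` starting at `u` whose label sequence
(the list of labels of the vertices on the walk) is `s`. -/
noncomputable def nWalks {V S : Type*} (G : SimpleGraph V) (L : V → S)
    (u : V) (i : ℕ) (s : List S) : ℕ :=
  Nat.card {q : (v' : V) × G.Walk u v' // q.2.length = i ∧ q.2.support.map L = s}

/-- The labeled-walk similarity `SimLW(u,v) = Σ_{i=1}^{r} λ_i · Σ_s n_u(s)·n_v(s)`, where
`s` ranges over label sequences of length `i+1`. -/
noncomputable def SimLW {V S : Type*} [Fintype S] (G : SimpleGraph V) (L : V → S)
    (r : ℕ) (lam : ℕ → ℝ) (u v : V) : ℝ :=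
  ∑ i ∈ Finset.Icc 1 r, lam i *
    ∑ s : Fin (i + 1) → S,
      (nWalks G L u i (List.ofFn s) : ℝ) * (nWalks G L v i (List.ofFn s) : ℝ)

/-- The number of walks of length `i` in `G` starting at `u` and ending at a vertex with
label `l`. -/
noncomputable def mWalks {V S : Type*} (G : SimpleGraph V) (L : V → S)
    (u : V) (i : ℕ) (l : S) : ℕ :=
  Nat.card {q : (v' : V) × G.Walk u v' // q.2.length = i ∧ L q.1 = l}

/-- The k-hops-neighbor similarity `SimKN(u,v) = Σ_{i=1}^{r} λ_i · Σ_{l ∈ Σ} m_u^i(l)·m_v^i(l)`. -/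
noncomputable def SimKN {V S : Type*} [Fintype S] (G : SimpleGraph V) (L : V → S)
    (r : ℕ) (lam : ℕ → ℝ) (u v : V) : ℝ :=
  ∑ i ∈ Finset.Icc 1 r, lam i *
    ∑ l : S, (mWalks G L u i l : ℝ) * (mWalks G L v i l : ℝ)

/-- There are finitely many walks of a given length from a vertex of a finite graph. -/
theorem finite_walks_of_length {V : Type*} [Finite V] (G : SimpleGraph V) (u : V) (i : ℕ) :
    Finite {q : (v' : V) × G.Walk u v' // q.2.length = i} := by
  classical
  have := Fintype.ofFinite V
  let f : ((v' : V) × {p : G.Walk u v' | p.length = i}) →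
      {q : (v' : V) × G.Walk u v' // q.2.length = i} := fun x => ⟨⟨x.1, x.2.1⟩, x.2.2⟩
  exact Finite.of_surjective f fun ⟨⟨v', p⟩, h⟩ => ⟨⟨v', ⟨p, h⟩⟩, rfl⟩

/-- The final label of the label sequence of a walk is the label of its endpoint. -/
theorem label_end_eq_of_support_map_eq {V S : Type*} {G : SimpleGraph V} {L : V → S} {u w : V}
    {i : ℕ} {p : G.Walk u w} {s : Fin (i + 1) → S} (h : p.support.map L = List.ofFn s) :
    L w = s (Fin.last i) := by
  have h' := congrArg List.getLast? h
  rw [List.getLast?_map, List.getLast?_eq_getLast_of_ne_nil p.support_ne_nil,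
    SimpleGraph.Walk.getLast_support, List.getLast?_eq_getLast_of_ne_nil (by simp),
    List.getLast_ofFn] at h'
  simpa [Fin.last] using h'

open Classical in
/-- Walks grouped by label sequences ending in `l` are among the walks ending at label `l`. -/
theorem sum_nWalks_le_mWalks {V S : Type*} [Finite V] [Fintype S] (G : SimpleGraph V)
    (L : V → S) (u : V) (i : ℕ) (l : S) :
    ∑ s : Fin (i + 1) → S with s (Fin.last i) = l, nWalks G L u i (List.ofFn s) ≤
      mWalks G L u i l := by
  have := finite_walks_of_length G u i
  have hfin (P : (v' : V) × G.Walk u v' → Prop) :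
      Finite {q : (v' : V) × G.Walk u v' // q.2.length = i ∧ P q} :=
    Finite.of_injective (β := {q : (v' : V) × G.Walk u v' // q.2.length = i})
      (fun q => ⟨q.1, q.2.1⟩) fun a b h => Subtype.ext (Subtype.mk.inj h)
  rw [← Finset.sum_subtype_eq_sum_filter, Finset.subtype_univ]
  unfold nWalks mWalks
  rw [← Nat.card_sigma]
  refine Nat.card_le_card_of_injective
    (fun x => ⟨x.2.1, x.2.2.1, (label_end_eq_of_support_map_eq x.2.2.2).trans x.1.2⟩) ?_
  rintro ⟨⟨s, hs⟩, q, hq⟩ ⟨⟨t, ht⟩, q', hq'⟩ h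
  obtain rfl : q = q' := Subtype.mk.inj h
  obtain rfl : s = t := List.ofFn_injective (hq.2.symm.trans hq'.2)
  rfl

theorem sum_nWalks_mul_le_sum_mWalks_mul {V S : Type*} [Finite V] [Fintype S]
    (G : SimpleGraph V) (L : V → S) (u v : V) (i : ℕ) :
    ∑ s : Fin (i + 1) → S, nWalks G L u i (List.ofFn s) * nWalks G L v i (List.ofFn s) ≤
      ∑ l : S, mWalks G L u i l * mWalks G L v i l := by
  classical
  rw [← Finset.sum_fiberwise Finset.univ (fun s : Fin (i + 1) → S => s (Fin.last i))]
  refine Finset.sum_le_sum fun l _ => ?_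
  refine le_trans ?_ (Nat.mul_le_mul (sum_nWalks_le_mWalks G L u i l)
    (sum_nWalks_le_mWalks G L v i l))
  rw [Finset.sum_mul]
  refine Finset.sum_le_sum fun s hs => Nat.mul_le_mul_left _ ?_
  exact Finset.single_le_sum (f := fun s => nWalks G L v i (List.ofFn s))
    (fun _ _ => Nat.zero_le _) hs

/-- With the same parameters `r` and `λ_i ≥ 0`, `SimLW(u,v) ≤ SimKN(u,v)`. -/
theorem stmt9 {V S : Type*} [Fintype V] [Fintype S]
    (G : SimpleGraph V) (L : V → S)
    (r : ℕ) (hr : 1 ≤ r) (lam : ℕ → ℝ) (hlam : ∀ i, 0 ≤ lam i) (u v : V) :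
    SimLW G L r lam u v ≤ SimKN G L r lam u v := by
  refine Finset.sum_le_sum fun i _ => mul_le_mul_of_nonneg_left ?_ (hlam i)
  exact_mod_cast sum_nWalks_mul_le_sum_mWalks_mul G L u v i
end
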